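/- For all integers n ≥ 7, the identity 2·∑_{i=4}^{n-3} ∑_{a=1}^{n-6} ∑_{j=1}^{a} C(i−2, j)·C(n−i−1, a+1−j)·C(a−1, j−1)·C(n−a−6, i−j−3) = ∑_{k=0}^{n-5} 2^{n−4−k}·C(2k, k) − (n−2)·2^{n−5} holds. -/

import Mathlib

/-- Binomial coefficient for integer arguments, with `C n k = 0` unless `0 ≤ k ≤ n`. -/
def C (n k : ℤ) : ℤ := if 0 ≤ k ∧ k ≤ n then (n.toNat.choose k.toNat : ℤ) else 0

/-! Auxiliary lemmas: marked intersections of a north-east and a north-west lattice path. -/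

/-- number of lattice paths -/
def pth (u y : ℕ) : ℤ := ((u + y).choose u : ℤ)

theorem pth_zero_left (y : ℕ) : pth 0 y = 1 := by simp [pth]
theorem pth_zero_right (y : ℕ) : pth y 0 = 1 := by simp [pth]
theorem pth_succ (u y : ℕ) : pth (u+1) (y+1) = pth u (y+1) + pth (u+1) y := by
  unfold pth
  have h : (u + 1 + (y + 1)).choose (u+1) = (u + (y+1)).choose u + (u + 1 + y).choose (u+1) := by
    rw [show u + 1 + (y+1) = (u + (y+1)) + 1 by ring, Nat.choose_succ_succ]
    rw [show u + 1 + y = u + (y+1) by ring]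
  exact_mod_cast h

theorem row_zero (K : ℕ) (h : ℕ → ℤ) :
    ∑ y ∈ Finset.range (K+1), pth 0 y * h y =
      h 0 + ∑ y ∈ Finset.range K, pth 0 y * h (y+1) := by
  rw [Finset.sum_range_succ', add_comm]
  simp [pth_zero_left]

theorem row_succ (M K : ℕ) (h : ℕ → ℤ) :
    ∑ y ∈ Finset.range (K+1), pth (M+1) y * h y =
      ∑ y ∈ Finset.range (K+1), pth M y * h y
      + ∑ y ∈ Finset.range K, pth (M+1) y * h (y+1) := by
  induction K with
  | zero => simp [pth_zero_right]
  | succ K ih =>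
    rw [Finset.sum_range_succ, ih, Finset.sum_range_succ _ (K+1), Finset.sum_range_succ _ K, pth_succ]
    rw [Finset.sum_range_succ (fun y => pth (M+1) y * h (y+1)) K]
    ring

theorem forward_sum (M K : ℕ) (h : ℕ → ℕ → ℤ) :
    ∑ u ∈ Finset.range (M+1), ∑ y ∈ Finset.range (K+1), pth u y * h u y =
      h 0 0 + ∑ u ∈ Finset.range M, ∑ y ∈ Finset.range (K+1), pth u y * h (u+1) y
        + ∑ u ∈ Finset.range (M+1), ∑ y ∈ Finset.range K, pth u y * h u (y+1) := by
  induction M with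
  | zero => simp [row_zero]
  | succ M ih =>
    rw [Finset.sum_range_succ, ih, row_succ, Finset.sum_range_succ (fun u => ∑ y ∈ Finset.range (K+1), pth u y * h (u+1) y) M,
      Finset.sum_range_succ (fun u => ∑ y ∈ Finset.range K, pth u y * h u (y+1)) (M+1)]
    ring

theorem reflect2 (M K : ℕ) (F : ℕ → ℕ → ℤ) :
    ∑ u ∈ Finset.range M, ∑ y ∈ Finset.range K, F (M-1-u) (K-1-y) =
    ∑ u ∈ Finset.range M, ∑ y ∈ Finset.range K, F u y := by
  rw [Finset.sum_range_reflect (fun u => ∑ y ∈ Finset.range K, F u (K-1-y)) M]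
  exact Finset.sum_congr rfl fun u _ => Finset.sum_range_reflect (F u) K

theorem backward_sum (M K : ℕ) (h : ℕ → ℕ → ℤ) :
    ∑ u ∈ Finset.range (M+1), ∑ y ∈ Finset.range (K+1), pth (M-u) (K-y) * h u y =
      h M K + ∑ u ∈ Finset.range M, ∑ y ∈ Finset.range (K+1), pth (M-1-u) (K-y) * h u y
        + ∑ u ∈ Finset.range (M+1), ∑ y ∈ Finset.range K, pth (M-u) (K-1-y) * h u y := by
  have := forward_sum M K (fun u y => h (M-u) (K-y))
  rw [← reflect2 (M+1) (K+1), ← reflect2 M (K+1), ← reflect2 (M+1) K] at this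
  simp only [Nat.add_sub_cancel, Nat.sub_zero] at this
  refine Eq.trans ?_ (this.trans ?_)
  · refine Finset.sum_congr rfl fun u hu => Finset.sum_congr rfl fun y hy => ?_
    simp only [Finset.mem_range] at hu hy
    rw [show M - (M-u) = u by omega, show K - (K-y) = y by omega]
  · congr 1
    · congr 1
      refine Finset.sum_congr rfl fun u hu => Finset.sum_congr rfl fun y hy => ?_
      simp only [Finset.mem_range] at hu hy
      rw [show M - (M-1-u+1) = u by omega, show K - (K-y) = y by omega]
    · refine Finset.sum_congr rfl fun u hu => Finset.sum_congr rfl fun y hy => ?_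
      simp only [Finset.mem_range] at hu hy
      rw [show M - (M-u) = u by omega, show K - (K-1-y+1) = y by omega]

/-- partial Vandermonde sum -/
def Phi (T n s y : ℕ) : ℤ := ∑ t ∈ Finset.range (y+1), (s.choose t : ℤ) * ((T-s).choose (n-t) : ℤ)

theorem Phi_left (T n s y : ℕ) (hs : s < T) (hy : y < n) :
    Phi T n s y - Phi T n (s+1) y = (s.choose y : ℤ) * ((T-(s+1)).choose (n-(y+1)) : ℤ) := by
  obtain ⟨r, rfl⟩ : ∃ r, T = s + 1 + r := ⟨T - (s+1), by omega⟩
  have e1 : s + 1 + r - s = r + 1 := by omega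
  have e2 : s + 1 + r - (s+1) = r := by omega
  induction y with
  | zero =>
    obtain ⟨k, rfl⟩ : ∃ k, n = k + 1 := ⟨n-1, by omega⟩
    simp only [Phi, zero_add, Finset.sum_range_one, e1, e2, Nat.sub_zero, Nat.add_sub_cancel,
      Nat.choose_succ_succ r k, Nat.choose_zero_right]
    push_cast; ring
  | succ y ih =>
    have ih := ih (by omega)
    unfold Phi at ih ⊢
    rw [Finset.sum_range_succ, Finset.sum_range_succ _ (y+1)]
    obtain ⟨k, rfl⟩ : ∃ k, n = y + 2 + k := ⟨n-(y+2), by omega⟩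
    rw [e1, e2] at ih ⊢
    rw [show y + 2 + k - (y+1) = k + 1 by omega] at *
    rw [show y + 2 + k - (y+1+1) = k by omega]
    rw [Nat.choose_succ_succ r k, Nat.choose_succ_succ s y]
    push_cast
    linarith

theorem Phi_up (T n s y : ℕ) (hs : s < T) (hy : y < n) :
    Phi T n (s+1) (y+1) - Phi T n s y =
      (s.choose (y+1) : ℤ) * ((T-(s+1)).choose (n-(y+1)) : ℤ) := by
  have h := Phi_left T n s y hs hy
  have h2 : Phi T n (s+1) (y+1) = Phi T n (s+1) y +
      ((s+1).choose (y+1) : ℤ) * ((T-(s+1)).choose (n-(y+1)) : ℤ) := by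
    unfold Phi; rw [Finset.sum_range_succ]
  rw [h2, Nat.choose_succ_succ s y]
  push_cast
  linarith

theorem Phi_end (M K : ℕ) :
    Phi (M+K+4) (K+2) (K+2) (K+1) = ((M+K+4).choose (K+2) : ℤ) - 1 := by
  have h := Nat.add_choose_eq (K+2) (M+2) (K+2)
  rw [Finset.Nat.sum_antidiagonal_eq_sum_range_succ_mk, Finset.sum_range_succ] at h
  rw [show M + K + 4 = K + 2 + (M+2) by ring, h]
  unfold Phi
  rw [show K + 2 + (M+2) - (K+2) = M + 2 by omega]
  push_cast
  simp

/-- the summand -/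
def tm (x y u z : ℕ) : ℤ :=
  pth u y * pth x z * ((x+y+2).choose (y+1) : ℤ) * ((u+z+2).choose (z+1) : ℤ)

def S0 (M K : ℕ) : ℤ :=
  ∑ u ∈ Finset.range M, ∑ y ∈ Finset.range K, tm (M-1-u) y u (K-1-y)

theorem S0_rec (M K : ℕ) :
    S0 (M+1) (K+1) = S0 M (K+1) + S0 (M+1) K
      + (((M+K+4).choose (K+2) : ℤ) - 2) * ((M+K).choose M : ℤ) := by
  set psi : ℕ → ℕ → ℤ := fun u y => Phi (M+K+4) (K+2) (M-u+y+2) (y+1) with hpsi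
  set w : ℕ → ℕ → ℤ := fun u y =>
    ((M-u+y+2).choose (y+1) : ℤ) * ((u+(K-y)+2).choose (K-y+1) : ℤ) with hw
  have hV := forward_sum M K (fun u y => pth (M-u) (K-y) * w u y)
  have hA := forward_sum M K (fun u y => pth (M-u) (K-y) * psi u y)
  have hB := backward_sum M K (fun u y => pth u y * psi u y)
  have hAB : ∑ u ∈ Finset.range (M+1), ∑ y ∈ Finset.range (K+1),
        pth u y * (pth (M-u) (K-y) * psi u y) =
      ∑ u ∈ Finset.range (M+1), ∑ y ∈ Finset.range (K+1),
        pth (M-u) (K-y) * (pth u y * psi u y) :=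
    Finset.sum_congr rfl fun u hu => Finset.sum_congr rfl fun y hy => by ring
  have hS : S0 (M+1) (K+1) = ∑ u ∈ Finset.range (M+1), ∑ y ∈ Finset.range (K+1),
      pth u y * (pth (M-u) (K-y) * w u y) := by
    unfold S0 tm
    refine Finset.sum_congr rfl fun u hu => Finset.sum_congr rfl fun y hy => ?_
    simp only [hw, Nat.add_sub_cancel]; ring
  have hH : ∑ u ∈ Finset.range M, ∑ y ∈ Finset.range (K+1),
        pth u y * (pth (M-(u+1)) (K-y) * w (u+1) y) =
      S0 M (K+1) + (∑ u ∈ Finset.range M, ∑ y ∈ Finset.range (K+1),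
        pth u y * (pth (M-(u+1)) (K-y) * psi (u+1) y) -
        ∑ u ∈ Finset.range M, ∑ y ∈ Finset.range (K+1),
        pth (M-1-u) (K-y) * (pth u y * psi u y)) := by
    unfold S0
    rw [← Finset.sum_sub_distrib, ← Finset.sum_add_distrib]
    refine Finset.sum_congr rfl fun u hu => ?_
    rw [← Finset.sum_sub_distrib, ← Finset.sum_add_distrib]
    refine Finset.sum_congr rfl fun y hy => ?_
    simp only [Finset.mem_range] at hu hy
    obtain ⟨x, rfl⟩ : ∃ x, M = x + u + 1 := ⟨M - (u+1), by omega⟩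
    obtain ⟨z, rfl⟩ : ∃ z, K = y + z := ⟨K - y, by omega⟩
    have hp := Phi_left (x+u+1+(y+z)+4) (y+z+2) (x+y+2) (y+1) (by omega) (by omega)
    simp only [hpsi, hw, tm]
    rw [show x + u + 1 - (u+1) = x by omega, show x + u + 1 - 1 - u = x by omega,
      show x + u + 1 - u + y + 2 = x + y + 2 + 1 by omega, show y + z - y = z by omega,
      show y + z + 1 - 1 - y = z by omega]
    rw [show x+u+1+(y+z)+4 - (x+y+2+1) = u + z + 2 by omega,
      show y + z + 2 - (y+1+1) = z by omega] at hp
    rw [show u + 1 + z + 2 = (u + z + 2) + 1 by ring, Nat.choose_succ_succ (u+z+2) z]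
    push_cast
    linear_combination (- pth u y * pth x z) * hp
  have hU : ∑ u ∈ Finset.range (M+1), ∑ y ∈ Finset.range K,
        pth u y * (pth (M-u) (K-(y+1)) * w u (y+1)) =
      S0 (M+1) K + (∑ u ∈ Finset.range (M+1), ∑ y ∈ Finset.range K,
        pth u y * (pth (M-u) (K-(y+1)) * psi u (y+1)) -
        ∑ u ∈ Finset.range (M+1), ∑ y ∈ Finset.range K,
        pth (M-u) (K-1-y) * (pth u y * psi u y)) := by
    unfold S0
    rw [← Finset.sum_sub_distrib, ← Finset.sum_add_distrib]
    refine Finset.sum_congr rfl fun u hu => ?_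
    rw [← Finset.sum_sub_distrib, ← Finset.sum_add_distrib]
    refine Finset.sum_congr rfl fun y hy => ?_
    simp only [Finset.mem_range] at hu hy
    obtain ⟨x, rfl⟩ : ∃ x, M = x + u := ⟨M - u, by omega⟩
    obtain ⟨z, rfl⟩ : ∃ z, K = y + z + 1 := ⟨K - (y+1), by omega⟩
    have hp := Phi_up (x+u+(y+z+1)+4) (y+z+1+2) (x+y+2) (y+1) (by omega) (by omega)
    simp only [hpsi, hw, tm]
    rw [show x + u - u = x by omega, show x + u + 1 - 1 - u = x by omega,
      show y + z + 1 - (y+1) = z by omega,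
      show y + z + 1 - 1 - y = z by omega, show x + (y+1) + 2 = x + y + 2 + 1 by ring]
    rw [show x+u+(y+z+1)+4 - (x+y+2+1) = u + z + 2 by omega,
      show y + z + 1 + 2 - (y+1+1) = z + 1 by omega] at hp
    rw [Nat.choose_succ_succ (x+y+2) (y+1)]
    push_cast
    linear_combination (- pth u y * pth x z) * hp
  have h0 : psi 0 0 = w 0 0 + 1 := by
    simp only [hpsi, hw, Phi]
    rw [show M + K + 4 - (M - 0 + 0 + 2) = K + 2 by omega]
    rw [Finset.sum_range_succ, Finset.sum_range_one]
    simp; ring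
  have h1 : psi M K = ((M+K+4).choose (K+2) : ℤ) - 1 := by
    simp only [hpsi]
    rw [show M - M + K + 2 = K + 2 by omega, Phi_end]
  have h2 : pth M K = ((M+K).choose M : ℤ) := rfl
  simp only [Nat.sub_zero] at hV hA hB
  rw [h0] at hA
  rw [h1] at hB
  rw [← h2, hS]
  linear_combination hV - hA + hAB + hB + hH + hU

def Tot (L : ℕ) : ℤ := ∑ M ∈ Finset.range (L+1), S0 (M+1) (L-M+1)

theorem S0_zero_left (K : ℕ) : S0 0 K = 0 := by simp [S0]
theorem S0_zero_right (K : ℕ) : S0 K 0 = 0 := by simp [S0]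

theorem vdm (L : ℕ) : ∑ M ∈ Finset.range (L+1),
    (((L+4).choose (L-M+2) : ℤ) - 2) * (L.choose M : ℤ) = ((2*(L+2)).choose (L+2) : ℤ) - 2 * 2^L := by
  have h := Nat.add_choose_eq L (L+4) (L+2)
  rw [Finset.Nat.sum_antidiagonal_eq_sum_range_succ_mk, Finset.sum_range_succ,
    Finset.sum_range_succ] at h
  simp only [Nat.choose_eq_zero_of_lt (show L < L + 1 by omega),
    Nat.choose_eq_zero_of_lt (show L < L + 2 by omega), zero_mul, add_zero] at h
  have h2 := Nat.sum_range_choose L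
  rw [show 2 * (L+2) = L + (L+4) by ring, h]
  have h3 : (2:ℤ)^L = ∑ m ∈ Finset.range (L+1), (L.choose m : ℤ) := by exact_mod_cast h2.symm
  rw [h3]
  push_cast
  rw [Finset.mul_sum, ← Finset.sum_sub_distrib]
  refine Finset.sum_congr rfl fun M hM => ?_
  simp only [Finset.mem_range] at hM
  rw [show L - M + 2 = L + 2 - M by omega]; ring

theorem Tot_rec (L : ℕ) :
    Tot (L+1) = 2 * Tot L + ((2*(L+3)).choose (L+3) : ℤ) - 2 * 2^(L+1) := by
  have h : Tot (L+1) = ∑ M ∈ Finset.range (L+1+1), (S0 M (L+1-M+1) + S0 (M+1) (L+1-M)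
      + (((L+1+4).choose (L+1-M+2) : ℤ) - 2) * ((L+1).choose M : ℤ)) := by
    unfold Tot
    refine Finset.sum_congr rfl fun M hM => ?_
    simp only [Finset.mem_range] at hM
    rw [S0_rec, show M + (L+1-M) = L + 1 by omega]
  rw [h, Finset.sum_add_distrib, Finset.sum_add_distrib, vdm, Finset.sum_range_succ',
    Finset.sum_range_succ (fun M => S0 (M+1) (L+1-M))]
  have e1 : ∑ M ∈ Finset.range (L+1), S0 (M+1) (L+1-(M+1)+1) = Tot L := by
    unfold Tot
    refine Finset.sum_congr rfl fun M hM => ?_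
    congr 1; omega
  have e2 : ∑ M ∈ Finset.range (L+1), S0 (M+1) (L+1-M) = Tot L := by
    unfold Tot
    refine Finset.sum_congr rfl fun M hM => ?_
    simp only [Finset.mem_range] at hM
    congr 1; omega
  rw [e1, e2, S0_zero_left, Nat.sub_self, S0_zero_right]
  ring

theorem Tot_eq (L : ℕ) : 2 * Tot L =
    ∑ k ∈ Finset.range (L+3), (2:ℤ)^(L+3-k) * ((2*k).choose k : ℤ) - ((L:ℤ)+5) * 2^(L+2) := by
  induction L with
  | zero => simp [Tot, S0, tm, pth, Finset.sum_range_succ, Nat.choose]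
  | succ L ih =>
    rw [Tot_rec, Finset.sum_range_succ]
    have : ∑ k ∈ Finset.range (L+1+2), (2:ℤ)^(L+1+3-k) * ((2*k).choose k : ℤ)
        = 2 * ∑ k ∈ Finset.range (L+3), (2:ℤ)^(L+3-k) * ((2*k).choose k : ℤ) := by
      rw [Finset.mul_sum]
      refine Finset.sum_congr rfl fun k hk => ?_
      simp only [Finset.mem_range] at hk
      rw [show L + 1 + 3 - k = (L + 3 - k) + 1 by omega, pow_succ]; ring
    rw [this, show L + 1 + 3 - (L+1+2) = 1 by omega, show L + 1 + 2 = L + 3 by ring]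
    push_cast
    linear_combination 2 * ih

theorem C_nat (n k : ℕ) : C (n:ℤ) (k:ℤ) = (n.choose k : ℤ) := by
  unfold C
  split_ifs with h
  · simp
  · rw [Nat.choose_eq_zero_of_lt (by omega)]; simp

theorem C_out (n k : ℤ) (h : k < 0 ∨ n < k) : C n k = 0 := by
  unfold C; rw [if_neg (by omega)]

theorem Tot_reindex (L : ℕ) :
    ∑ a ∈ Finset.range (L+1), ∑ j ∈ Finset.range (a+1), ∑ p ∈ Finset.range (L-a+1),
      tm j p (L-a-p) (a-j) = Tot L := by
  unfold Tot S0
  simp only [Finset.sum_sigma']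
  refine Finset.sum_bij' (fun t _ => ⟨L - t.1 - t.2.2 + t.2.1, ⟨L - t.1 - t.2.2, t.2.2⟩⟩)
    (fun t _ => ⟨(t.1 - t.2.1) + (L - t.1 - t.2.2), ⟨t.1 - t.2.1, t.2.2⟩⟩) ?_ ?_ ?_ ?_ ?_
  · rintro ⟨a, ⟨j, p⟩⟩ h
    simp only [Finset.mem_sigma, Finset.mem_range] at h ⊢
    omega
  · rintro ⟨a, ⟨j, p⟩⟩ h
    simp only [Finset.mem_sigma, Finset.mem_range] at h ⊢
    omega
  · rintro ⟨a, ⟨j, p⟩⟩ h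
    simp only [Finset.mem_sigma, Finset.mem_range] at h
    simp only [Sigma.mk.injEq, heq_eq_eq, and_true]
    omega
  · rintro ⟨a, ⟨j, p⟩⟩ h
    simp only [Finset.mem_sigma, Finset.mem_range] at h
    simp only [Sigma.mk.injEq, heq_eq_eq, and_true]
    omega
  · rintro ⟨a, ⟨j, p⟩⟩ h
    simp only [Finset.mem_sigma, Finset.mem_range] at h
    simp only
    congr 1 <;> omega

theorem inner_i_sum (L a j : ℕ) (ha : a ≤ L) (hj : j ≤ a) :
    ∑ i ∈ Finset.range (L+1), C ((i:ℤ)+2) ((j:ℤ)+1) * C ((L:ℤ)+2-i) ((a:ℤ)+1-j) *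
      C (a:ℤ) (j:ℤ) * C ((L:ℤ)-a) ((i:ℤ)-j) =
    ∑ p ∈ Finset.range (L-a+1), tm j p (L-a-p) (a-j) := by
  have hsub : Finset.Ico j (j + (L-a+1)) ⊆ Finset.range (L+1) := by
    intro i; simp only [Finset.mem_Ico, Finset.mem_range]; omega
  rw [← Finset.sum_subset hsub]
  · rw [Finset.sum_Ico_eq_sum_range, Nat.add_sub_cancel_left]
    refine Finset.sum_congr rfl fun p hp => ?_
    simp only [Finset.mem_range] at hp
    obtain ⟨b, rfl⟩ : ∃ b, a = j + b := ⟨a - j, by omega⟩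
    obtain ⟨q, rfl⟩ : ∃ q, L = j + b + p + q := ⟨L - (j+b+p), by omega⟩
    rw [show j + b + p + q - (j+b) - p = q by omega, show j + b - j = b by omega]
    rw [show ((j+p:ℕ):ℤ) + 2 = ((j+p+2:ℕ):ℤ) by push_cast; ring,
      show (j:ℤ) + 1 = ((j+1:ℕ):ℤ) by push_cast; ring,
      show ((j+b+p+q:ℕ):ℤ) + 2 - ((j+p:ℕ):ℤ) = ((q+b+2:ℕ):ℤ) by push_cast; ring,
      show ((j+b:ℕ):ℤ) + 1 - (j:ℤ) = ((b+1:ℕ):ℤ) by push_cast; ring,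
      show ((j+b+p+q:ℕ):ℤ) - ((j+b:ℕ):ℤ) = ((q+p:ℕ):ℤ) by push_cast; ring,
      show ((j+p:ℕ):ℤ) - (j:ℤ) = ((p:ℕ):ℤ) by push_cast; ring]
    simp only [C_nat, tm, pth]
    rw [Nat.choose_symm_of_eq_add (show j + p + 2 = (j+1) + (p+1) by ring),
      Nat.choose_symm_of_eq_add (show q + p = q + p by ring)]
    ring
  · intro i hi hi2
    simp only [Finset.mem_Ico, Finset.mem_range] at hi hi2
    rw [C_out ((L:ℤ)-a) ((i:ℤ)-j) (by omega), mul_zero]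

theorem statement17 (n : ℕ) (hn : 7 ≤ n) :
    2 * ∑ i ∈ Finset.Icc 4 (n-3), ∑ a ∈ Finset.Icc 1 (n-6), ∑ j ∈ Finset.Icc 1 a,
        C ((i:ℤ)-2) (j:ℤ) * C ((n:ℤ)-(i:ℤ)-1) ((a:ℤ)+1-(j:ℤ)) *
          C ((a:ℤ)-1) ((j:ℤ)-1) * C ((n:ℤ)-(a:ℤ)-6) ((i:ℤ)-(j:ℤ)-3)
      = ∑ k ∈ Finset.Icc 0 (n-5), (2:ℤ)^(n-4-k) * C (2*(k:ℤ)) (k:ℤ)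
          - ((n:ℤ)-2) * 2^(n-5) := by
  obtain ⟨L, rfl⟩ : ∃ L, n = L + 7 := ⟨n - 7, by omega⟩
  have hI : ∀ (c m : ℕ) (F : ℕ → ℤ), ∑ i ∈ Finset.Icc c (m + c), F i =
      ∑ i ∈ Finset.range (m+1), F (i + c) := by
    intro c m F
    rw [← Finset.Ico_add_one_right_eq_Icc, Finset.sum_Ico_eq_sum_range,
      show m + c + 1 - c = m + 1 by omega]
    exact Finset.sum_congr rfl fun i _ => by rw [add_comm]
  rw [show L + 7 - 3 = L + 4 by omega, show L + 7 - 6 = L + 1 by omega,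
    show L + 7 - 5 = (L + 2) + 0 by omega, show L + 7 - 4 = L + 3 by omega]
  simp only [hI]
  have key : ∑ i ∈ Finset.range (L+1), ∑ a ∈ Finset.range (L+1), ∑ j ∈ Finset.range (a+1),
      C (((i+4:ℕ):ℤ)-2) ((j+1:ℕ):ℤ) * C (((L+7:ℕ):ℤ)-((i+4:ℕ):ℤ)-1) (((a+1:ℕ):ℤ)+1-((j+1:ℕ):ℤ)) *
          C (((a+1:ℕ):ℤ)-1) (((j+1:ℕ):ℤ)-1) *
          C (((L+7:ℕ):ℤ)-((a+1:ℕ):ℤ)-6) (((i+4:ℕ):ℤ)-((j+1:ℕ):ℤ)-3) = Tot L := by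
    rw [← Tot_reindex, Finset.sum_comm]
    refine Finset.sum_congr rfl fun a ha => ?_
    rw [Finset.sum_comm]
    refine Finset.sum_congr rfl fun j hj => ?_
    simp only [Finset.mem_range] at ha hj
    rw [← inner_i_sum L a j (by omega) (by omega)]
    refine Finset.sum_congr rfl fun i hi => ?_
    push_cast
    congr 1
    · congr 1
      · congr 1 <;> congr 1 <;> ring
      · congr 1 <;> ring
    · congr 1 <;> ring
  rw [key, Tot_eq]
  congr 1
  · refine Finset.sum_congr rfl fun k hk => ?_
    rw [← C_nat]; push_cast; rfl
  · push_cast; ring
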